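/- With the notation of the previous statement, suppose φ = T_{2α−1} h for some h in the space H_{2α−1} of measurable functions ψ:[0,1]→ℝ^d with ∫₀¹∫₀¹ |ψ(t)||ψ(s)|/|t−s|^{2α−1} dt ds < ∞. Then (G_Σ)_α^*(φ) = (1/(2σ²)) (h, T_{2α−1} h), where (ψ₁,ψ₂)_Σ := ∫₀¹∫₀¹ ψ₁(t)·Σψ₂(s)/|t−s|^{2α−1} dt ds = (ψ₁, T_{2α−1}ψ₂). -/

import Mathlib

open MeasureTheory Matrix

/-- one-sided weighted kernel -/
noncomputable def auxK (α p q t u : ℝ) : ℝ := |t - u| ^ (-α) * (if 0 ≤ t - u then p else q)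

lemma auxK_nonneg {α p q : ℝ} (hp : 0 ≤ p) (hq : 0 ≤ q) (t u : ℝ) : 0 ≤ auxK α p q t u := by
  unfold auxK; split_ifs <;> positivity

lemma auxK_meas (α p q : ℝ) : Measurable (fun z : ℝ × ℝ => auxK α p q z.1 z.2) := by
  unfold auxK
  refine Measurable.mul ?_ ?_
  · exact ((measurable_fst.sub measurable_snd).abs).pow_const _
  · exact Measurable.ite (measurableSet_le measurable_const (measurable_fst.sub measurable_snd))
      measurable_const measurable_const

lemma auxK_lt {α p q J : ℝ} 
    (hJ : J = ∫ x : ℝ, auxK α p q (x + 1) 0 * auxK α p q x 0) (hJ0 : 0 < J)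
    {s t : ℝ} (hst : s < t) :
    Integrable (fun u => auxK α p q t u * auxK α p q s u) ∧
    ∫ u, auxK α p q t u * auxK α p q s u = J * |t - s| ^ (-(2 * α - 1)) := by
  have hint : Integrable (fun x : ℝ => auxK α p q (x + 1) 0 * auxK α p q x 0) := by
    by_contra hc
    rw [integral_undef hc] at hJ
    linarith
  set g := (fun x : ℝ => auxK α p q (x + 1) 0 * auxK α p q x 0) with hg
  have ha : 0 < t - s := by linarith
  have key : (fun u => auxK α p q t u * auxK α p q s u) =
      fun u => (t - s) ^ (-(2 * α)) * g ((s - u) / (t - s)) := by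
    funext u
    have e1 : (s - u) / (t - s) + 1 = (t - u) / (t - s) := by field_simp; ring
    have c : ∀ y : ℝ, (0 ≤ y / (t - s)) ↔ 0 ≤ y := fun y => by
      rw [le_div_iff₀ ha, zero_mul]
    have e2 : ∀ y : ℝ, |y / (t - s)| ^ (-α) = |y| ^ (-α) * (t - s) ^ α := fun y => by
      rw [abs_div, abs_of_pos ha, Real.div_rpow (abs_nonneg _) ha.le, Real.rpow_neg ha.le,
        div_inv_eq_mul]
    have e3 : (t - s) ^ (-(2 * α)) * ((t - s) ^ α * (t - s) ^ α) = 1 := by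
      rw [← Real.rpow_add ha, ← Real.rpow_add ha]
      have : -(2 * α) + (α + α) = 0 := by ring
      rw [this, Real.rpow_zero]
    simp only [hg, auxK, sub_zero, e1, c, e2]
    linear_combination (-(|t - u| ^ (-α) * (if 0 ≤ t - u then p else q) * (|s - u| ^ (-α) *
      (if 0 ≤ s - u then p else q)))) * e3
  have hi2 : Integrable (fun u => g ((s - u) / (t - s))) :=
    (hint.comp_div ha.ne').comp_sub_left s
  refine ⟨by rw [key]; exact hi2.const_mul _, ?_⟩
  rw [key, integral_const_mul, integral_sub_left_eq_self (fun y => g (y / (t - s))) volume s,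
    Measure.integral_comp_div, ← hJ, abs_of_pos ha, smul_eq_mul]
  have : (t - s) ^ (-(2 * α - 1)) = (t - s) ^ (-(2 * α)) * (t - s) := by
    have e : -(2 * α - 1) = -(2 * α) + 1 := by ring
    rw [e, Real.rpow_add ha, Real.rpow_one]
  rw [this]; ring

lemma auxK_ne {α p q J : ℝ} 
    (hJ : J = ∫ x : ℝ, auxK α p q (x + 1) 0 * auxK α p q x 0) (hJ0 : 0 < J)
    {s t : ℝ} (hst : t ≠ s) :
    Integrable (fun u => auxK α p q t u * auxK α p q s u) ∧
    ∫ u, auxK α p q t u * auxK α p q s u = J * |t - s| ^ (-(2 * α - 1)) := by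
  rcases lt_or_gt_of_ne hst with h | h
  · have := auxK_lt hJ hJ0 h
    simp only [mul_comm (auxK α p q s _)] at this
    rwa [abs_sub_comm] at this
  · exact auxK_lt hJ hJ0 h

/-- Lebesgue measure on the unit interval -/
noncomputable abbrev auxμ : Measure ℝ := volume.restrict (Set.Ioc (0:ℝ) 1)

lemma aux_diag : ∀ᵐ z ∂(auxμ.prod auxμ), z.1 ≠ z.2 := by
  have hm : MeasurableSet {z : ℝ × ℝ | z.1 ≠ z.2} :=
    (measurableSet_eq_fun measurable_fst measurable_snd).compl
  rw [Measure.ae_prod_iff_ae_ae hm]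
  refine Filter.Eventually.of_forall fun x => ?_
  have : ∀ᵐ y ∂auxμ, y ≠ x := by
    rw [ae_iff]; simp
  filter_upwards [this] with y hy using hy.symm

lemma aux_pd {α p q J : ℝ} (hp : 0 ≤ p) (hq : 0 ≤ q)
    (hJ : J = ∫ x : ℝ, auxK α p q (x + 1) 0 * auxK α p q x 0) (hJ0 : 0 < J)
    {f : ℝ → ℝ} (hf : Measurable f)
    (hfi : Integrable (fun z : ℝ × ℝ => |z.1 - z.2| ^ (-(2 * α - 1)) * (f z.1 * f z.2))
      (auxμ.prod auxμ)) :
    0 ≤ ∫ z : ℝ × ℝ, |z.1 - z.2| ^ (-(2 * α - 1)) * (f z.1 * f z.2) ∂(auxμ.prod auxμ) := by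
  set G : ℝ × ℝ → ℝ → ℝ := fun z u =>
    (f z.1 * f z.2) * (auxK α p q z.1 u * auxK α p q z.2 u) with hG
  have hGm : Measurable (Function.uncurry G) := by
    have m1 : Measurable (fun w : (ℝ × ℝ) × ℝ => auxK α p q w.1.1 w.2) :=
      (auxK_meas α p q).comp ((measurable_fst.comp measurable_fst).prodMk measurable_snd)
    have m2 : Measurable (fun w : (ℝ × ℝ) × ℝ => auxK α p q w.1.2 w.2) :=
      (auxK_meas α p q).comp ((measurable_snd.comp measurable_fst).prodMk measurable_snd)
    exact ((hf.comp (measurable_fst.comp measurable_fst)).mul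
      (hf.comp (measurable_snd.comp measurable_fst))).mul (m1.mul m2)
  have hGi : Integrable (Function.uncurry G) ((auxμ.prod auxμ).prod volume) := by
    rw [integrable_prod_iff hGm.aestronglyMeasurable]
    constructor
    · filter_upwards [aux_diag] with z hz
      exact (auxK_ne hJ hJ0 hz).1.const_mul (f z.1 * f z.2)
    · refine (hfi.norm.const_mul J).congr ?_
      filter_upwards [aux_diag] with z hz
      have : ∀ u, ‖Function.uncurry G (z, u)‖ =
          |f z.1 * f z.2| * (auxK α p q z.1 u * auxK α p q z.2 u) := fun u => by
        simp only [Function.uncurry, hG, Real.norm_eq_abs]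
        rw [abs_mul, abs_of_nonneg (mul_nonneg (auxK_nonneg hp hq _ _) (auxK_nonneg hp hq _ _))]
      simp only [this]
      rw [integral_const_mul, (auxK_ne hJ hJ0 hz).2, Real.norm_eq_abs, abs_mul,
        abs_of_nonneg (Real.rpow_nonneg (abs_nonneg _) _)]
      ring
  have e1 : ∫ z, ∫ u, G z u ∂volume ∂(auxμ.prod auxμ) =
      J * ∫ z : ℝ × ℝ, |z.1 - z.2| ^ (-(2 * α - 1)) * (f z.1 * f z.2) ∂(auxμ.prod auxμ) := by
    rw [← integral_const_mul]
    refine integral_congr_ae ?_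
    filter_upwards [aux_diag] with z hz
    simp only [hG]
    rw [integral_const_mul, (auxK_ne hJ hJ0 hz).2]; ring
  have e2 : 0 ≤ ∫ z, ∫ u, G z u ∂volume ∂(auxμ.prod auxμ) := by
    rw [integral_integral_swap hGi]
    refine integral_nonneg fun u => ?_
    have : (fun z : ℝ × ℝ => G z u) = fun z => (f z.1 * auxK α p q z.1 u) *
      (f z.2 * auxK α p q z.2 u) := by
      funext z; simp only [hG]; ring
    simp only [Pi.zero_apply]
    rw [this, integral_prod_mul (fun t => f t * auxK α p q t u) (fun t => f t * auxK α p q t u)]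
    exact mul_self_nonneg _
  rw [e1] at e2
  exact (mul_nonneg_iff_of_pos_left hJ0).1 e2

lemma aux_kernel_int {r : ℝ} (hr1 : r < 1) {v : ℝ → ℝ} (hv : Integrable v auxμ) :
    Integrable (fun z : ℝ × ℝ => v z.2 * |z.1 - z.2| ^ (-r)) (auxμ.prod auxμ) := by
  have hl : LocallyIntegrable (fun x : ℝ => |x| ^ (-r)) := by
    refine locallyIntegrable_of_norm_le_rpow (C := 1) (α := r) (by simp) (by simpa using hr1) ?_ ?_
    · refine Filter.Eventually.of_forall fun x => ?_
      rw [Real.norm_eq_abs, Real.norm_eq_abs, one_mul,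
        abs_of_nonneg (Real.rpow_nonneg (abs_nonneg _) _)]
    · exact ((measurable_id.abs).pow_const _).aestronglyMeasurable
  have h1 : Integrable ((Set.Icc (-1:ℝ) 1).indicator (fun x : ℝ => |x| ^ (-r))) :=
    (hl.integrableOn_isCompact isCompact_Icc).integrable_indicator measurableSet_Icc
  have h2 := Integrable.convolution_integrand (ContinuousLinearMap.mul ℝ ℝ) hv h1
  have h3 : Integrable (fun z : ℝ × ℝ => v z.2 *
    (Set.Icc (-1:ℝ) 1).indicator (fun x : ℝ => |x| ^ (-r)) (z.1 - z.2)) (auxμ.prod auxμ) := by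
    have := h2.mono_measure (μ := auxμ.prod auxμ)
      (Measure.prod_mono Measure.restrict_le_self le_rfl)
    simpa using this
  refine h3.congr ?_
  rw [Measure.prod_restrict]
  filter_upwards [ae_restrict_mem (measurableSet_Ioc.prod measurableSet_Ioc)] with z hz
  rw [Set.indicator_of_mem]
  simp only [Set.mem_prod, Set.mem_Ioc] at hz
  constructor <;> linarith [hz.1.1, hz.1.2, hz.2.1, hz.2.2]

open scoped MatrixOrder Matrix.Norms.L2Operator in
lemma aux_factor {d : ℕ} {S : Matrix (Fin d) (Fin d) ℝ} (hS : S.PosSemidef) :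
    ∃ B : Matrix (Fin d) (Fin d) ℝ, S = Bᵀ * B := by
  have h0 : 0 ≤ S := Matrix.nonneg_iff_posSemidef.2 hS
  obtain ⟨B, hB⟩ := CStarAlgebra.nonneg_iff_eq_star_mul_self.1 h0
  exact ⟨B, by rw [hB, Matrix.star_eq_conjTranspose, Matrix.conjTranspose_eq_transpose_of_trivial]⟩

lemma aux_dot {d : ℕ} (S : Matrix (Fin d) (Fin d) ℝ) :
    ∃ C : ℝ, 0 ≤ C ∧ ∀ x y : Fin d → ℝ, |x ⬝ᵥ S.mulVec y| ≤ C * (‖x‖ * ‖y‖) := by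
  refine ⟨∑ i, ∑ j, |S i j|, by positivity, fun x y => ?_⟩
  simp only [dotProduct, mulVec, Finset.mul_sum, Finset.sum_mul]
  refine (Finset.abs_sum_le_sum_abs _ _).trans (Finset.sum_le_sum fun i _ => ?_)
  refine (Finset.abs_sum_le_sum_abs _ _).trans (Finset.sum_le_sum fun j _ => ?_)
  rw [abs_mul, abs_mul]
  have h1 : |x i| ≤ ‖x‖ := norm_le_pi_norm x i
  have h2 : |y j| ≤ ‖y‖ := norm_le_pi_norm y j
  calc |x i| * (|S i j| * |y j|) ≤ ‖x‖ * (|S i j| * ‖y‖) := by gcongr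
    _ = _ := by ring

/-- admissibility of a pair -/
def auxA {d : ℕ} (r : ℝ) (u v : ℝ → Fin d → ℝ) : Prop :=
  Integrable (fun z : ℝ × ℝ => ‖u z.1‖ * ‖v z.2‖ * |z.1 - z.2| ^ (-r)) (auxμ.prod auxμ)

/-- integrand of the bilinear form -/
noncomputable def auxI {d : ℕ} (S : Matrix (Fin d) (Fin d) ℝ) (r : ℝ) (u v : ℝ → Fin d → ℝ)
    (z : ℝ × ℝ) : ℝ := |z.1 - z.2| ^ (-r) * (u z.1 ⬝ᵥ S.mulVec (v z.2))

/-- the bilinear form -/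
noncomputable def auxQ {d : ℕ} (S : Matrix (Fin d) (Fin d) ℝ) (r : ℝ) (u v : ℝ → Fin d → ℝ) : ℝ :=
  ∫ z, auxI S r u v z ∂(auxμ.prod auxμ)

lemma aux_mulVec_meas {d : ℕ} (S : Matrix (Fin d) (Fin d) ℝ) {v : ℝ → Fin d → ℝ}
    (hv : Measurable v) : Measurable (fun t => S.mulVec (v t)) := by
  have : Continuous (fun x : Fin d → ℝ => S.mulVec x) := by fun_prop
  exact this.measurable.comp hv

lemma auxI_meas {d : ℕ} (S : Matrix (Fin d) (Fin d) ℝ) (r : ℝ) {u v : ℝ → Fin d → ℝ}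
    (hu : Measurable u) (hv : Measurable v) : Measurable (auxI S r u v) := by
  unfold auxI
  refine (((measurable_fst.sub measurable_snd).abs).pow_const _).mul ?_
  have c : Continuous (fun w : (Fin d → ℝ) × (Fin d → ℝ) => w.1 ⬝ᵥ S.mulVec w.2) := by fun_prop
  exact c.measurable.comp ((hu.comp measurable_fst).prodMk (hv.comp measurable_snd))

lemma auxI_int {d : ℕ} (S : Matrix (Fin d) (Fin d) ℝ) {r : ℝ} {u v : ℝ → Fin d → ℝ}
    (hu : Measurable u) (hv : Measurable v) (hA : auxA r u v) :
    Integrable (auxI S r u v) (auxμ.prod auxμ) := by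
  obtain ⟨C, hC, hb⟩ := aux_dot S
  refine Integrable.mono' (hA.const_mul C) (auxI_meas S r hu hv).aestronglyMeasurable ?_
  refine Filter.Eventually.of_forall fun z => ?_
  have hk : 0 ≤ |z.1 - z.2| ^ (-r) := Real.rpow_nonneg (abs_nonneg _) _
  rw [auxI, Real.norm_eq_abs, abs_mul, abs_of_nonneg hk]
  nlinarith [mul_le_mul_of_nonneg_left (hb (u z.1) (v z.2)) hk]

lemma aux_iter {d : ℕ} (S : Matrix (Fin d) (Fin d) ℝ) {r : ℝ} {u v : ℝ → Fin d → ℝ}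
    (hu : Measurable u) (hv : Measurable v) (hA : auxA r u v) :
    ∫ t in Set.Ioc (0:ℝ) 1, u t ⬝ᵥ (∫ s in Set.Ioc (0:ℝ) 1, |t - s| ^ (-r) • S.mulVec (v s)) =
      auxQ S r u v := by
  rw [auxQ, integral_prod _ (auxI_int S hu hv hA)]
  refine integral_congr_ae ?_
  have h1 := ((integrable_prod_iff hA.aestronglyMeasurable).1 hA).1
  filter_upwards [h1] with t ht
  simp only [auxI]
  by_cases h0 : u t = 0
  · simp [h0]
  have hn : ‖u t‖ ≠ 0 := norm_ne_zero_iff.2 h0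
  have ht2 : Integrable (fun s => |t - s| ^ (-r) • v s) auxμ := by
    refine Integrable.mono' (ht.const_mul ‖u t‖⁻¹) ?_ ?_
    · exact (((measurable_const.sub measurable_id).abs.pow_const _).smul hv).aestronglyMeasurable
    · refine Filter.Eventually.of_forall fun s => ?_
      rw [norm_smul, Real.norm_eq_abs, abs_of_nonneg (Real.rpow_nonneg (abs_nonneg _) _)]
      apply le_of_eq
      field_simp
  let M : (Fin d → ℝ) →L[ℝ] (Fin d → ℝ) := LinearMap.toContinuousLinearMap S.mulVecLin
  let D : (Fin d → ℝ) →L[ℝ] ℝ := LinearMap.toContinuousLinearMap (dotProductBilin ℝ ℝ (u t))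
  have ht3 : Integrable (fun s => |t - s| ^ (-r) • S.mulVec (v s)) auxμ := by
    have := M.integrable_comp ht2
    refine this.congr (Filter.Eventually.of_forall fun s => ?_)
    simp [M]
  have := D.integral_comp_comm ht3
  have hD : ∀ x, D x = u t ⬝ᵥ x := fun x => rfl
  simp only [hD] at this
  rw [← this]
  refine integral_congr_ae (Filter.Eventually.of_forall fun s => ?_)
  simp [dotProduct_smul]

lemma aux_symm {d : ℕ} {S : Matrix (Fin d) (Fin d) ℝ} (hS : S.PosSemidef) (r : ℝ)
    (u v : ℝ → Fin d → ℝ) : auxQ S r u v = auxQ S r v u := by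
  unfold auxQ
  rw [← integral_prod_swap]
  congr 1; funext z
  have hT : Sᵀ = S := by
    have := hS.isHermitian.eq
    rwa [Matrix.conjTranspose_eq_transpose_of_trivial] at this
  simp only [auxI, Prod.fst_swap, Prod.snd_swap]
  rw [abs_sub_comm, dotProduct_mulVec, ← mulVec_transpose, hT, dotProduct_comm]

lemma aux_Qnonneg {d : ℕ} {S : Matrix (Fin d) (Fin d) ℝ} (hS : S.PosSemidef)
    {α p q J : ℝ} (hp : 0 ≤ p) (hq : 0 ≤ q)
    (hJ : J = ∫ x : ℝ, auxK α p q (x + 1) 0 * auxK α p q x 0) (hJ0 : 0 < J)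
    {u : ℝ → Fin d → ℝ} (hu : Measurable u) (hA : auxA (2 * α - 1) u u) :
    0 ≤ auxQ S (2 * α - 1) u u := by
  obtain ⟨B, hB⟩ := aux_factor hS
  have hm : ∀ i, Measurable (fun t => (B.mulVec (u t)) i) := fun i =>
    (measurable_pi_apply i).comp (aux_mulVec_meas B hu)
  have hi : ∀ i, Integrable (fun z : ℝ × ℝ => |z.1 - z.2| ^ (-(2 * α - 1)) *
      ((B.mulVec (u z.1)) i * (B.mulVec (u z.2)) i)) (auxμ.prod auxμ) := by
    intro i
    have := auxI_int (Bᵀ * Matrix.diagonal (Pi.single i 1) * B) hu hu hA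
    refine this.congr (Filter.Eventually.of_forall fun z => ?_)
    simp only [auxI]
    rw [← mulVec_mulVec, ← mulVec_mulVec, dotProduct_mulVec, ← mulVec_transpose, transpose_transpose]
    congr 1
    simp only [dotProduct, mulVec_diagonal]
    rw [Finset.sum_eq_single i]
    · simp
    · intro j _ hj; simp [hj]
    · simp
  have e : auxQ S (2 * α - 1) u u = ∑ i, ∫ z : ℝ × ℝ, |z.1 - z.2| ^ (-(2 * α - 1)) *
      ((B.mulVec (u z.1)) i * (B.mulVec (u z.2)) i) ∂(auxμ.prod auxμ) := by
    rw [← integral_finsetSum _ (fun i _ => hi i), auxQ]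
    congr 1; funext z
    rw [auxI, hB, ← mulVec_mulVec, dotProduct_mulVec, ← mulVec_transpose, transpose_transpose,
      ← Finset.mul_sum]
    rfl
  rw [e]
  exact Finset.sum_nonneg fun i _ => aux_pd hp hq hJ hJ0 (hm i) (hi i)

lemma auxA_bdd {d : ℕ} {r : ℝ} (hr : r < 1) {u v : ℝ → Fin d → ℝ} (hu : Measurable u)
    {C : ℝ} (hC : ∀ t, ‖u t‖ ≤ C) (hv : Measurable v) (hvi : Integrable v auxμ) :
    auxA r u v := by
  refine Integrable.mono' ((aux_kernel_int hr hvi.norm).const_mul C) ?_ ?_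
  · exact (((hu.comp measurable_fst).norm.mul (hv.comp measurable_snd).norm).mul
      ((measurable_fst.sub measurable_snd).abs.pow_const _)).aestronglyMeasurable
  · refine Filter.Eventually.of_forall fun z => ?_
    have hk : 0 ≤ |z.1 - z.2| ^ (-r) := Real.rpow_nonneg (abs_nonneg _) _
    rw [Real.norm_eq_abs, abs_of_nonneg (by positivity), mul_assoc]
    exact mul_le_mul_of_nonneg_right (hC _) (by positivity)

lemma auxA_swap {d : ℕ} {r : ℝ} {u v : ℝ → Fin d → ℝ} (hA : auxA r u v) : auxA r v u := by
  have := hA.swap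
  refine this.congr (Filter.Eventually.of_forall fun z => ?_)
  simp only [Function.comp, Prod.fst_swap, Prod.snd_swap]
  rw [abs_sub_comm]; ring

lemma auxA_L1 {d : ℕ} {r : ℝ} (hr : 0 < r) {v : ℝ → Fin d → ℝ} (hv : Measurable v)
    (hA : auxA r v v) : Integrable v auxμ := by
  have h1 := ((integrable_prod_iff hA.aestronglyMeasurable).1 hA).1
  by_cases h0 : ∀ᵐ t ∂auxμ, v t = 0
  · exact (integrable_zero _ _ _).congr (by filter_upwards [h0] with t ht using ht.symm)
  have hm : ∀ᵐ t ∂auxμ, t ∈ Set.Ioc (0:ℝ) 1 := ae_restrict_mem measurableSet_Ioc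
  obtain ⟨t, ht0, ht, htm⟩ :=
    ((Filter.not_eventually.1 h0).and_eventually (h1.and hm)).exists
  have hn : 0 < ‖v t‖ := norm_pos_iff.2 ht0
  refine Integrable.mono' (ht.const_mul ‖v t‖⁻¹) hv.aestronglyMeasurable ?_
  have hd : ∀ᵐ y ∂auxμ, y ≠ t := by
    rw [ae_iff]; simp
  filter_upwards [hm, hd] with s hs hst
  have hk : 1 ≤ |t - s| ^ (-r) := by
    apply Real.one_le_rpow_of_pos_of_le_one_of_nonpos
    · exact abs_pos.2 (sub_ne_zero.2 hst.symm)
    · rw [abs_le]; constructor <;> linarith [hs.1, hs.2, htm.1, htm.2]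
    · linarith
  have : ‖v t‖⁻¹ * (‖v t‖ * ‖v s‖ * |t - s| ^ (-r)) = ‖v s‖ * |t - s| ^ (-r) := by
    field_simp
  rw [this]
  exact le_mul_of_one_le_right (norm_nonneg _) hk

lemma aux_tendsto {d : ℕ} (S : Matrix (Fin d) (Fin d) ℝ) {r : ℝ} {h : ℝ → Fin d → ℝ}
    (hA : auxA r h h) (u v : ℕ → ℝ → Fin d → ℝ)
    (hum : ∀ n, Measurable (u n)) (hvm : ∀ n, Measurable (v n))
    (hu : ∀ n t, ‖u n t‖ ≤ ‖h t‖) (hv : ∀ n t, ‖v n t‖ ≤ ‖h t‖)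
    (hue : ∀ t, ∀ᶠ n in Filter.atTop, u n t = h t)
    (hve : ∀ t, ∀ᶠ n in Filter.atTop, v n t = h t) :
    Filter.Tendsto (fun n => auxQ S r (u n) (v n)) Filter.atTop (nhds (auxQ S r h h)) := by
  obtain ⟨C, hC, hb⟩ := aux_dot S
  refine tendsto_integral_of_dominated_convergence _
    (fun n => (auxI_meas S r (hum n) (hvm n)).aestronglyMeasurable) (hA.const_mul C) ?_ ?_
  · intro n
    refine Filter.Eventually.of_forall fun z => ?_
    have hk : 0 ≤ |z.1 - z.2| ^ (-r) := Real.rpow_nonneg (abs_nonneg _) _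
    rw [auxI, Real.norm_eq_abs, abs_mul, abs_of_nonneg hk]
    have h1 : |u n z.1 ⬝ᵥ S.mulVec (v n z.2)| ≤ C * (‖h z.1‖ * ‖h z.2‖) := by
      refine (hb _ _).trans ?_
      have := hu n z.1
      have := hv n z.2
      gcongr
    nlinarith [mul_le_mul_of_nonneg_left h1 hk]
  · refine Filter.Eventually.of_forall fun z => ?_
    refine tendsto_const_nhds.congr' ?_
    filter_upwards [hue z.1, hve z.2] with n h1 h2
    simp only [auxI, h1, h2]

lemma auxQ_smul_left {d : ℕ} (S : Matrix (Fin d) (Fin d) ℝ) (r c : ℝ) (u v : ℝ → Fin d → ℝ) :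
    auxQ S r (fun t => c • u t) v = c * auxQ S r u v := by
  simp only [auxQ, ← integral_const_mul]
  congr 1; funext z
  simp only [auxI, smul_dotProduct, smul_eq_mul]; ring

lemma auxQ_smul_right {d : ℕ} (S : Matrix (Fin d) (Fin d) ℝ) (r c : ℝ) (u v : ℝ → Fin d → ℝ) :
    auxQ S r u (fun t => c • v t) = c * auxQ S r u v := by
  simp only [auxQ, ← integral_const_mul]
  congr 1; funext z
  simp only [auxI, mulVec_smul, dotProduct_smul, smul_eq_mul]; ring

lemma auxA_sub {d : ℕ} {r c : ℝ} {u h : ℝ → Fin d → ℝ} (hum : Measurable u)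
    (hhm : Measurable h) (huu : auxA r u u) (huh : auxA r u h) (hhh : auxA r h h) :
    auxA r (fun t => c • u t - h t) (fun t => c • u t - h t) := by
  have hhu := auxA_swap huh
  have hm : Measurable (fun t => c • u t - h t) := (hum.const_smul c).sub hhm
  refine Integrable.mono' ((((huu.const_mul (|c| * |c|)).add (huh.const_mul |c|)).add
    (hhu.const_mul |c|)).add hhh) ?_ ?_
  · exact (((hm.comp measurable_fst).norm.mul (hm.comp measurable_snd).norm).mul
      ((measurable_fst.sub measurable_snd).abs.pow_const _)).aestronglyMeasurable
  · refine Filter.Eventually.of_forall fun z => ?_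
    have hk : 0 ≤ |z.1 - z.2| ^ (-r) := Real.rpow_nonneg (abs_nonneg _) _
    have b : ∀ t, ‖c • u t - h t‖ ≤ |c| * ‖u t‖ + ‖h t‖ := fun t =>
      (norm_sub_le _ _).trans (by rw [norm_smul, Real.norm_eq_abs])
    rw [Real.norm_eq_abs, abs_of_nonneg (by positivity)]
    have := mul_le_mul_of_nonneg_right
      (mul_le_mul (b z.1) (b z.2) (norm_nonneg _) (by positivity)) hk
    refine this.trans (le_of_eq ?_)
    simp only [Pi.add_apply]
    ring

lemma auxQ_sub {d : ℕ} {S : Matrix (Fin d) (Fin d) ℝ} (hS : S.PosSemidef) {r c : ℝ}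
    {u h : ℝ → Fin d → ℝ} (hum : Measurable u)
    (hhm : Measurable h) (huu : auxA r u u) (huh : auxA r u h) (hhh : auxA r h h) :
    auxQ S r (fun t => c • u t - h t) (fun t => c • u t - h t) =
      c ^ 2 * auxQ S r u u - 2 * c * auxQ S r u h + auxQ S r h h := by
  have i1 := (auxI_int S hum hum huu).const_mul (c ^ 2)
  have i2 := (auxI_int S hum hhm huh).const_mul c
  have i3 := (auxI_int S hhm hum (auxA_swap huh)).const_mul c
  have i4 := auxI_int S hhm hhm hhh
  have e : auxQ S r (fun t => c • u t - h t) (fun t => c • u t - h t) =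
      c ^ 2 * auxQ S r u u - c * auxQ S r u h - c * auxQ S r h u + auxQ S r h h := by
    simp only [auxQ, ← integral_const_mul]
    have i12 : Integrable (fun z => c ^ 2 * auxI S r u u z - c * auxI S r u h z)
      (auxμ.prod auxμ) := i1.sub i2
    have i123 : Integrable (fun z => c ^ 2 * auxI S r u u z - c * auxI S r u h z -
      c * auxI S r h u z) (auxμ.prod auxμ) := i12.sub i3
    rw [← integral_sub i1 i2, ← integral_sub i12 i3, ← integral_add i123 i4]
    congr 1; funext z
    simp only [auxI, sub_dotProduct, mulVec_sub, dotProduct_sub, mulVec_smul, smul_dotProduct,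
      dotProduct_smul, smul_eq_mul]
    ring
  rw [e, aux_symm hS r h u]; ring

/-- If `φ = T_{2α−1} h` for some `h ∈ H_{2α−1}`, then
`(G_Σ)_α^*(φ) = (1/(2σ²)) (h, T_{2α−1}h)`. -/
theorem stmt7
    {d : ℕ} (S : Matrix (Fin d) (Fin d) ℝ) (hS : S.PosSemidef)
    (α p q : ℝ) (hα : 1 / 2 < α) (hα1 : α < 1)
    (hp0 : 0 ≤ p) (hp1 : p ≤ 1) (hq : q = 1 - p)
    (σ2 : ℝ)
    (hσ2 : σ2 = ∫ x : ℝ, (1 - α) ^ 2 * |x + 1| ^ (-α) * |x| ^ (-α) *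
      (if 0 ≤ x + 1 then p else q) * (if 0 ≤ x then p else q))
    (hσ2pos : 0 < σ2)
    (h : ℝ → Fin d → ℝ) (hhmeas : Measurable h)
    (hH : IntegrableOn
      (fun z : ℝ × ℝ => ‖h z.1‖ * ‖h z.2‖ * |z.1 - z.2| ^ (-(2 * α - 1)))
      (Set.Ioc (0:ℝ) 1 ×ˢ Set.Ioc (0:ℝ) 1) volume)
    (φ : ℝ → Fin d → ℝ)
    (hφT : ∀ t ∈ Set.Ioc (0:ℝ) 1,
      φ t = ∫ s in Set.Ioc (0:ℝ) 1, |t - s| ^ (-(2 * α - 1)) • S.mulVec (h s)) :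
    (⨆ ψ : {ψ : ℝ → Fin d → ℝ // Measurable ψ ∧ ∃ C, ∀ t, ‖ψ t‖ ≤ C},
      (((∫ t in Set.Ioc (0:ℝ) 1, ψ.1 t ⬝ᵥ φ t) -
        σ2 / 2 * ∫ t in Set.Ioc (0:ℝ) 1,
          ψ.1 t ⬝ᵥ (∫ s in Set.Ioc (0:ℝ) 1,
            |t - s| ^ (-(2 * α - 1)) • S.mulVec (ψ.1 s)) :
        ℝ) : EReal))
    =
    (((1 / (2 * σ2)) * ∫ t in Set.Ioc (0:ℝ) 1,
        h t ⬝ᵥ (∫ s in Set.Ioc (0:ℝ) 1,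
          |t - s| ^ (-(2 * α - 1)) • S.mulVec (h s)) : ℝ) : EReal) := by
  have hq0 : 0 ≤ q := by rw [hq]; linarith
  set r : ℝ := 2 * α - 1 with hr
  have hr0 : 0 < r := by linarith
  have hr1 : r < 1 := by linarith
  obtain ⟨J, hJ⟩ : ∃ J, J = ∫ x : ℝ, auxK α p q (x + 1) 0 * auxK α p q x 0 := ⟨_, rfl⟩
  have hJ0 : 0 < J := by
    have e : σ2 = (1 - α) ^ 2 * J := by
      rw [hσ2, hJ, ← integral_const_mul]
      congr 1; funext x
      simp only [auxK, sub_zero]; ring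
    rw [e] at hσ2pos
    exact pos_of_mul_pos_right hσ2pos (sq_nonneg _)
  have hhh : auxA r h h := by
    unfold auxA
    rw [Measure.prod_restrict]
    exact hH
  have hL1 : Integrable h auxμ := auxA_L1 hr0 hhmeas hhh
  have ebdd : ∀ ψ : ℝ → Fin d → ℝ, Measurable ψ → (∃ C, ∀ t, ‖ψ t‖ ≤ C) →
      auxA r ψ ψ ∧ auxA r ψ h := by
    rintro ψ hm ⟨C, hC⟩
    have hi : Integrable ψ auxμ :=
      Integrable.of_bound hm.aestronglyMeasurable C (Filter.Eventually.of_forall hC)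
    exact ⟨auxA_bdd hr1 hm hC hm hi, auxA_bdd hr1 hm hC hhmeas hL1⟩
  have hval : ∀ ψ : ℝ → Fin d → ℝ, Measurable ψ → (∃ C, ∀ t, ‖ψ t‖ ≤ C) →
      ((∫ t in Set.Ioc (0:ℝ) 1, ψ t ⬝ᵥ φ t) -
        σ2 / 2 * ∫ t in Set.Ioc (0:ℝ) 1,
          ψ t ⬝ᵥ (∫ s in Set.Ioc (0:ℝ) 1, |t - s| ^ (-r) • S.mulVec (ψ s))) =
      auxQ S r ψ h - σ2 / 2 * auxQ S r ψ ψ := by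
    intro ψ hm hb
    obtain ⟨h1, h2⟩ := ebdd ψ hm hb
    rw [aux_iter S hm hm h1, ← aux_iter S hm hhmeas h2]
    congr 1
    refine setIntegral_congr_fun measurableSet_Ioc fun t ht => ?_
    simp only [hφT t ht]
  rw [aux_iter S hhmeas hhmeas hhh]
  apply le_antisymm
  · refine iSup_le fun ψ => ?_
    obtain ⟨ψ, hm, hb⟩ := ψ
    obtain ⟨h1, h2⟩ := ebdd ψ hm hb
    simp only [hval ψ hm hb]
    rw [EReal.coe_le_coe_iff]
    have hn := aux_Qnonneg hS hp0 hq0 hJ hJ0 ((hm.const_smul σ2).sub hhmeas)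
      (auxA_sub (c := σ2) hm hhmeas h1 h2 hhh)
    have e := auxQ_sub hS (c := σ2) hm hhmeas h1 h2 hhh
    have hn2 : 0 ≤ σ2 ^ 2 * auxQ S r ψ ψ - 2 * σ2 * auxQ S r ψ h + auxQ S r h h := by
      rw [← e]; exact hn
    rw [one_div, inv_mul_eq_div, le_div_iff₀ (by positivity)]
    nlinarith
  · let g : ℕ → ℝ → Fin d → ℝ := fun n t => if ‖h t‖ ≤ n then h t else 0
    have gm : ∀ n, Measurable (g n) := fun n =>
      Measurable.ite (measurableSet_le hhmeas.norm measurable_const) hhmeas measurable_const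
    have gle : ∀ n t, ‖g n t‖ ≤ ‖h t‖ := fun n t => by
      simp only [g]; split_ifs <;> simp
    have gb : ∀ n t, ‖g n t‖ ≤ n := fun n t => by
      simp only [g]; split_ifs with hc
      · exact hc
      · simp
    have ge : ∀ t, ∀ᶠ n in Filter.atTop, g n t = h t := fun t => by
      obtain ⟨N, hN⟩ := exists_nat_ge ‖h t‖
      filter_upwards [Filter.eventually_ge_atTop N] with n hn
      have : ‖h t‖ ≤ n := hN.trans (by exact_mod_cast hn)
      simp [g, this]
    have T1 := aux_tendsto S hhh g (fun _ => h) gm (fun _ => hhmeas) gle (fun _ _ => le_rfl) ge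
      (fun _ => Filter.Eventually.of_forall fun _ => rfl)
    have T2 := aux_tendsto S hhh g g gm gm gle gle ge ge
    have T : Filter.Tendsto (fun n => σ2⁻¹ * auxQ S r (g n) h -
        σ2 / 2 * (σ2⁻¹ * (σ2⁻¹ * auxQ S r (g n) (g n)))) Filter.atTop
        (nhds (1 / (2 * σ2) * auxQ S r h h)) := by
      have := (T1.const_mul σ2⁻¹).sub (((T2.const_mul σ2⁻¹).const_mul σ2⁻¹).const_mul (σ2 / 2))
      convert this using 2
      field_simp
      ring
    refine le_of_tendsto ((continuous_coe_real_ereal.tendsto _).comp T)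
      (Filter.Eventually.of_forall fun n => ?_)
    have bm : Measurable (fun t => σ2⁻¹ • g n t) := (gm n).const_smul σ2⁻¹
    have bb : ∃ C, ∀ t, ‖σ2⁻¹ • g n t‖ ≤ C := ⟨‖σ2⁻¹‖ * n, fun t => by
      rw [norm_smul]; exact mul_le_mul_of_nonneg_left (gb n t) (norm_nonneg _)⟩
    refine le_trans (le_of_eq ?_) (le_iSup _ ⟨fun t => σ2⁻¹ • g n t, bm, bb⟩)
    simp only [hval _ bm bb, auxQ_smul_left, auxQ_smul_right, Function.comp]
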